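/- If the operators X_0(z),...,X_n(z) satisfy the ZF algebra X_α(y)X_β(x) = ∑_{γ,δ} R(y/x)^{β,α}_{γ,δ} X_γ(x)X_δ(y) with R the ASEP R matrix, then setting X_α = X_α(1) and X̂_α = (1−t)·(d/dz)X_α(z)|_{z=1}, the hat relation t^{θ(α>β)} X_β X_α − t^{θ(α<β)} X_α X_β = X_α X̂_β − X̂_α X_β holds for all 0 ≤ α, β ≤ n. -/

import Mathlib

/-- The ASEP R matrix: `Rmat t z a b c d = R(z)^{a,b}_{c,d}`. -/
def Rmat {K : Type*} [DivisionRing K] {n : ℕ} (t z : K) (a b c d : Fin (n + 1)) : K :=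
  if a = c ∧ b = d then
    (if c = d then 1 else (1 - z) * t ^ (if c < d then 1 else 0) / (1 - t * z))
  else if a = d ∧ b = c then (1 - t) * z ^ (if d < c then 1 else 0) / (1 - t * z)
  else 0

open Polynomial in
theorem poly_zero_of_eval {K A : Type*} [Field K] [Infinite K] [Ring A] [Algebra K A]
    (P : Polynomial A) (c₀ : K)
    (h : ∀ c : K, c ≠ c₀ → P.eval (algebraMap K A c) = 0) : P = 0 := by
  ext i
  rw [coeff_zero, ← Module.forall_dual_apply_eq_zero_iff K]
  intro f
  set q : Polynomial K := ∑ i ∈ P.support, C (f (P.coeff i)) * X ^ i with hq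
  have hq0 : q = 0 := by
    apply Polynomial.eq_zero_of_infinite_isRoot
    refine Set.Infinite.mono (s := {c₀}ᶜ) ?_ (Set.finite_singleton c₀).infinite_compl
    intro c hc
    have h1 := h c hc
    have h2 : q.eval c = f (P.eval (algebraMap K A c)) := by
      rw [Polynomial.eval_eq_sum (p := P), Polynomial.sum, map_sum, hq, eval_finsetSum]
      refine Finset.sum_congr rfl fun i _ => ?_
      rw [← map_pow, ← Algebra.commutes, ← Algebra.smul_def, map_smul]
      rw [eval_mul, eval_C, eval_pow, eval_X, smul_eq_mul, mul_comm]
    show q.eval c = 0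
    rw [h2, h1, map_zero]
  have h3 : q.coeff i = f (P.coeff i) := by
    rw [hq, finsetSum_coeff]
    simp only [coeff_C_mul_X_pow]
    rw [Finset.sum_ite_eq]
    split_ifs with hi
    · rfl
    · rw [notMem_support_iff.1 hi, map_zero]
  rw [← h3, hq0, coeff_zero]

theorem eval_mul_alg {K A : Type*} [Field K] [Ring A] [Algebra K A]
    (P Q : Polynomial A) (c : K) :
    (P * Q).eval (algebraMap K A c) = P.eval (algebraMap K A c) * Q.eval (algebraMap K A c) :=
  Polynomial.eval₂_mul_noncomm _ _ fun _ => (Algebra.commute_algebraMap_right c _)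

theorem eval_mul_one' {A : Type*} [Ring A] (P Q : Polynomial A) :
    (P * Q).eval 1 = P.eval 1 * Q.eval 1 :=
  Polynomial.eval₂_mul_noncomm _ _ fun _ => Commute.one_right _

theorem Rmat_sum_ne {K A : Type*} [Field K] [Ring A] [Algebra K A] {n : ℕ} (t z : K)
    (α β : Fin (n + 1)) (h : α ≠ β) (F : Fin (n + 1) → Fin (n + 1) → A) :
    ∑ γ, ∑ δ, Rmat t z β α γ δ • F γ δ =
      ((1 - z) * t ^ (if β < α then 1 else 0) / (1 - t * z)) • F β α +
      ((1 - t) * z ^ (if β < α then 1 else 0) / (1 - t * z)) • F α β := by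
  have key : ∀ γ δ, Rmat t z β α γ δ • F γ δ =
      (if β = γ then if α = δ then
        ((1 - z) * t ^ (if β < α then 1 else 0) / (1 - t * z)) • F β α else 0 else 0) +
      (if α = γ then if β = δ then
        ((1 - t) * z ^ (if β < α then 1 else 0) / (1 - t * z)) • F α β else 0 else 0) := by
    intro γ δ
    unfold Rmat
    by_cases h1 : β = γ
    · subst h1
      by_cases h2 : α = δ
      · subst h2; simp [h, h.symm]
      · simp [h, h2]
    · by_cases h2 : α = γ
      · subst h2
        by_cases h3 : β = δ
        · subst h3; simp [h1]
        · simp [h1, h3]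
      · simp [h1, h2]
  simp only [key, Finset.sum_add_distrib, Finset.sum_ite_eq, Finset.mem_univ, if_true,
    Finset.sum_const_zero, Finset.sum_ite_irrel]

theorem Rmat_sum_eq {K A : Type*} [Field K] [Ring A] [Algebra K A] {n : ℕ} (t z : K)
    (α : Fin (n + 1)) (F : Fin (n + 1) → Fin (n + 1) → A) :
    ∑ γ, ∑ δ, Rmat t z α α γ δ • F γ δ = F α α := by
  have key : ∀ γ δ, Rmat t z α α γ δ • F γ δ =
      (if α = γ then if α = δ then F α α else 0 else 0) := by
    intro γ δ
    unfold Rmat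
    by_cases h1 : α = γ
    · subst h1
      by_cases h2 : α = δ
      · subst h2; simp
      · simp [h2]
    · simp [h1]
  simp only [key, Finset.sum_ite_eq, Finset.mem_univ, if_true,
    Finset.sum_const_zero, Finset.sum_ite_irrel]

/-- If the polynomial families `X_α(z) ∈ A[z]` (`A` an associative `ℚ(t)`-algebra) satisfy
the ZF algebra `X_α(y)X_β(x) = ∑_{γ,δ} R(y/x)^{β,α}_{γ,δ} X_γ(x)X_δ(y)`, then with
`X_α = X_α(1)` and `X̂_α = (1−t)·(d/dz)X_α(z)|_{z=1}` the hat relation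
`t^{θ(α>β)} X_β X_α − t^{θ(α<β)} X_α X_β = X_α X̂_β − X̂_α X_β` holds. -/
theorem stmt12 {A : Type*} [Ring A] [Algebra (RatFunc ℚ) A] {n : ℕ}
    (X : Fin (n + 1) → Polynomial A)
    (hZF : ∀ x y : RatFunc ℚ, x ≠ 0 → 1 - RatFunc.X * (y / x) ≠ 0 →
      ∀ α β : Fin (n + 1),
        (X α).eval (algebraMap (RatFunc ℚ) A y) * (X β).eval (algebraMap (RatFunc ℚ) A x)
          = ∑ γ : Fin (n + 1), ∑ δ : Fin (n + 1),
              Rmat (RatFunc.X : RatFunc ℚ) (y / x) β α γ δ •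
                ((X γ).eval (algebraMap (RatFunc ℚ) A x) *
                  (X δ).eval (algebraMap (RatFunc ℚ) A y))) :
    ∀ α β : Fin (n + 1),
      ((RatFunc.X : RatFunc ℚ) ^ (if β < α then 1 else 0)) • ((X β).eval 1 * (X α).eval 1)
        - ((RatFunc.X : RatFunc ℚ) ^ (if α < β then 1 else 0)) • ((X α).eval 1 * (X β).eval 1)
      = (X α).eval 1 * ((1 - (RatFunc.X : RatFunc ℚ)) • (Polynomial.derivative (X β)).eval 1)
        - ((1 - (RatFunc.X : RatFunc ℚ)) • (Polynomial.derivative (X α)).eval 1) *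
            (X β).eval 1 := by
  intro α β
  set t : RatFunc ℚ := RatFunc.X with ht
  have ht0 : t ≠ 0 := RatFunc.X_ne_zero
  have : Infinite (RatFunc ℚ) := inferInstance
  have hne : ∀ y : RatFunc ℚ, y ≠ t⁻¹ → 1 - t * y ≠ 0 := by
    intro y hy h0
    exact hy (eq_inv_of_mul_eq_one_right (sub_eq_zero.1 h0).symm)
  by_cases hab : α = β
  · subst hab
    have hP : X α * Polynomial.C ((X α).eval 1) - Polynomial.C ((X α).eval 1) * X α = 0 := by
      apply poly_zero_of_eval _ (t⁻¹)
      intro y hy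
      have h1 := hZF 1 y one_ne_zero (by simpa using hne y hy) α α
      rw [Rmat_sum_eq t (y / 1) α (fun γ δ => (X γ).eval (algebraMap (RatFunc ℚ) A 1) *
                  (X δ).eval (algebraMap (RatFunc ℚ) A y))] at h1
      rw [map_one] at h1
      simp [Polynomial.eval_sub, eval_mul_alg, h1]
    have hd := congrArg (fun p => (Polynomial.derivative p).eval 1) hP
    simp [Polynomial.derivative_mul, eval_mul_one'] at hd
    rw [sub_self, mul_smul_comm, smul_mul_assoc, ← smul_sub, sub_eq_zero.1 hd]
    simp
  · have hP : (1 - Polynomial.C (algebraMap _ A t) * Polynomial.X) *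
          (X α * Polynomial.C ((X β).eval 1))
        - ((1 - Polynomial.X) * (Polynomial.C (algebraMap _ A (t ^ (if β < α then 1 else 0))) *
            (Polynomial.C ((X β).eval 1) * X α))
          + Polynomial.C (algebraMap _ A (1 - t)) * (Polynomial.X ^ (if β < α then 1 else 0) *
            (Polynomial.C ((X α).eval 1) * X β))) = 0 := by
      apply poly_zero_of_eval _ (t⁻¹)
      intro y hy
      have h0 := hne y hy
      have h1 := hZF 1 y one_ne_zero (by simpa using h0) α β
      rw [Rmat_sum_ne t (y / 1) α β hab (fun γ δ => (X γ).eval (algebraMap (RatFunc ℚ) A 1) *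
                  (X δ).eval (algebraMap (RatFunc ℚ) A y))] at h1
      rw [map_one, div_one] at h1
      have h2 := congrArg (fun a => (1 - t * y) • a) h1
      simp only [smul_add, smul_smul, mul_div_cancel₀ _ h0] at h2
      rw [Polynomial.eval_sub, sub_eq_zero]
      have e : (Polynomial.X ^ (if β < α then 1 else 0) : Polynomial A).eval
          (algebraMap (RatFunc ℚ) A y) = algebraMap _ A (y ^ (if β < α then 1 else 0)) := by
        split_ifs <;> simp
      simp only [Polynomial.eval_sub, Polynomial.eval_add, eval_mul_alg, e, Polynomial.eval_C,
        Polynomial.eval_X, Polynomial.eval_one]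
      simp only [Algebra.smul_def, map_sub, map_mul, map_one, mul_assoc] at h2 ⊢
      exact h2
    have hd := congrArg (fun p => (Polynomial.derivative p).eval 1) hP
    simp only [Polynomial.derivative_sub, Polynomial.derivative_add, Polynomial.derivative_mul,
      Polynomial.eval_sub, Polynomial.eval_add, eval_mul_one', Polynomial.derivative_C,
      Polynomial.derivative_X, Polynomial.derivative_one, Polynomial.eval_C,
      Polynomial.eval_X, Polynomial.eval_one, Polynomial.derivative_zero,
      Polynomial.eval_zero] at hd
    rw [mul_smul_comm, smul_mul_assoc]
    simp only [Algebra.smul_def]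
    rcases lt_or_gt_of_ne hab with h | h
    · simp [h, h.not_gt] at hd ⊢
      rw [← sub_eq_zero, ← hd]
      noncomm_ring
    · simp [h, h.not_gt] at hd ⊢
      rw [← sub_eq_zero, ← hd]
      noncomm_ring
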